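/- arXiv:1709.08163 — 3 statements merged into one kernel-verified Lean document; each statement's English description precedes it below -/
import Mathlib

section
/- Let N ≥ 1 and let w(i,j) be real numbers defined for all 0 ≤ i < j ≤ N+1. Define a_1, ..., a_N recursively by a_k = w(0,k) + Σ_{j=1}^{k-1} a_j · w(j,k), and set A = w(0,N+1) + Σ_{j=1}^{N} a_j · w(j,N+1). Then A equals the sum over all subsets I ⊆ {1,...,N} of Π(I), where Π(I) is the weight of the chain through the elements of {0} ∪ ({1,...,N} \ I) ∪ {N+1} taken in increasing order (in particular, the term for I = {1,...,N} is w(0,N+1)). Equivalently, A is the sum of the weights of all chains from 0 to N+1. -/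
/-- The weight of a chain, given as the list of its vertices:
the product of `w` over consecutive pairs of vertices. -/
noncomputable def chainWeight (w : ℕ → ℕ → ℝ) : List ℕ → ℝ
  | a :: b :: rest => w a b * chainWeight w (b :: rest)
  | _ => 1

/-- The chain from `i` to `j` whose intermediate vertices are the
elements of `S`, taken in increasing order. -/
def chainList (i j : ℕ) (S : Finset ℕ) : List ℕ :=
  (i :: S.sort (· ≤ ·)) ++ [j]

/-- The sum, over all strictly increasing finite sequences
`i = c_0 < c_1 < ... < c_m = j` (`m ≥ 1`), of the products
`Π_{l=0}^{m-1} w(c_l, c_{l+1})`.  Such chains are in bijection with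
finite sets `S ⊆ Ioo i j` of intermediate vertices. -/
noncomputable def chainSum (w : ℕ → ℕ → ℝ) (i j : ℕ) : ℝ :=
  ∑ S ∈ (Finset.Ioo i j).powerset, chainWeight w (chainList i j S)

/-- `Π(I)`: the weight of the chain through `{0} ∪ ({1,...,N} \ I) ∪ {N+1}`
in increasing order. -/
noncomputable def PiW (w : ℕ → ℕ → ℝ) (N : ℕ) (I : Finset ℕ) : ℝ :=
  chainWeight w (chainList 0 (N + 1) (Finset.Icc 1 N \ I))

/-- Appending one more vertex multiplies the weight of a chain by the new transition factor. -/
theorem chainWeight_append_pair (w : ℕ → ℕ → ℝ) (a b : ℕ) :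
    ∀ l : List ℕ, chainWeight w (l ++ [a, b]) = chainWeight w (l ++ [a]) * w a b
  | [] => by simp [chainWeight]
  | [c] => by simp [chainWeight]
  | c :: d :: l => by
    have ih := chainWeight_append_pair w a b (d :: l)
    simp only [List.cons_append, chainWeight] at ih ⊢
    rw [ih, mul_assoc]

theorem sort_insert_of_forall_lt {j : ℕ} {T : Finset ℕ} (hT : ∀ x ∈ T, x < j) :
    (insert j T).sort (· ≤ ·) = T.sort (· ≤ ·) ++ [j] := by
  have hj : j ∉ T := fun h => lt_irrefl j (hT j h)
  refine List.Perm.eq_of_pairwise' (r := (· ≤ ·)) (Finset.pairwise_sort _ _) ?_ ?_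
  · rw [List.pairwise_append]
    refine ⟨Finset.pairwise_sort _ _, List.pairwise_singleton _ _, fun x hx y hy => ?_⟩
    rw [List.mem_singleton.mp hy]
    exact (hT x ((Finset.mem_sort _).mp hx)).le
  · refine (List.perm_ext_iff_of_nodup (Finset.sort_nodup _ _) ?_).mpr fun x => ?_
    · simpa [List.nodup_append] using fun x hx => (hT x hx).ne
    · simp [or_comm]

/-- A sum over subsets of an open interval, split according to the maximum of the subset. -/
theorem sum_powerset_Ioo_eq_add_sum_insert (f : Finset ℕ → ℝ) (i k : ℕ) :
    ∑ S ∈ (Finset.Ioo i k).powerset, f S =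
      f ∅ + ∑ j ∈ Finset.Ioo i k, ∑ T ∈ (Finset.Ioo i j).powerset, f (insert j T) := by
  induction k with
  | zero => simp
  | succ k ih =>
    rcases lt_or_ge i k with h | h
    · have hk : k ∉ Finset.Ioo i k := by simp
      have hI : Finset.Ioo i (k + 1) = insert k (Finset.Ioo i k) := by
        ext x
        simp only [Finset.mem_Ioo, Finset.mem_insert]
        omega
      rw [hI, Finset.sum_powerset_insert hk, Finset.sum_insert hk, ih]
      ring
    · have hI : Finset.Ioo i (k + 1) = ∅ := by
        ext x
        simp only [Finset.mem_Ioo, Finset.notMem_empty, iff_false]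
        omega
      simp [hI]

/-- Recursion for the chain sum on the last intermediate vertex. -/
theorem chainSum_eq_add_sum (w : ℕ → ℕ → ℝ) (i k : ℕ) :
    chainSum w i k = w i k + ∑ j ∈ Finset.Ioo i k, chainSum w i j * w j k := by
  unfold chainSum
  rw [sum_powerset_Ioo_eq_add_sum_insert]
  congr 1
  · simp [chainList, chainWeight]
  · refine Finset.sum_congr rfl fun j _ => ?_
    rw [Finset.sum_mul]
    refine Finset.sum_congr rfl fun T hT => ?_
    have hlt : ∀ x ∈ T, x < j := fun x hx =>
      (Finset.mem_Ioo.mp (Finset.mem_powerset.mp hT hx)).2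
    rw [chainList, sort_insert_of_forall_lt hlt, chainList, ← chainWeight_append_pair]
    simp

/-- Complementation turns the sum over removed vertices into the sum over chains. -/
theorem sum_PiW_eq_chainSum (w : ℕ → ℕ → ℝ) (N : ℕ) :
    ∑ I ∈ (Finset.Icc 1 N).powerset, PiW w N I = chainSum w 0 (N + 1) := by
  have hI : Finset.Ioo 0 (N + 1) = Finset.Icc 1 N := by
    ext x
    simp only [Finset.mem_Ioo, Finset.mem_Icc]
    omega
  rw [chainSum, hI]
  refine Finset.sum_nbij' (Finset.Icc 1 N \ ·) (Finset.Icc 1 N \ ·) ?_ ?_ ?_ ?_ ?_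
  · exact fun I _ => Finset.mem_powerset.mpr Finset.sdiff_subset
  · exact fun I _ => Finset.mem_powerset.mpr Finset.sdiff_subset
  · exact fun I hI => Finset.sdiff_sdiff_eq_self (Finset.mem_powerset.mp hI)
  · exact fun I hI => Finset.sdiff_sdiff_eq_self (Finset.mem_powerset.mp hI)
  · exact fun I _ => rfl

/-- Algorithm 2 computes the unnormalized marginal likelihood:
`A = w(0,N+1) + Σ_{j=1}^N a_j w(j,N+1)` equals the sum over all subsets
`I ⊆ {1,...,N}` of `Π(I)`, and equivalently the sum of the weights of all
chains from `0` to `N+1`. -/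
theorem marginal_likelihood_eq_sum_over_subsets (N : ℕ) (hN : 1 ≤ N)
    (w : ℕ → ℕ → ℝ) (a : ℕ → ℝ) (A : ℝ)
    (ha : ∀ k, 1 ≤ k → k ≤ N →
      a k = w 0 k + ∑ j ∈ Finset.Ico 1 k, a j * w j k)
    (hA : A = w 0 (N + 1) + ∑ j ∈ Finset.Icc 1 N, a j * w j (N + 1)) :
    A = ∑ I ∈ (Finset.Icc 1 N).powerset, PiW w N I ∧
    A = chainSum w 0 (N + 1) := by
  have hsum : ∀ k, 1 ≤ k → k ≤ N → a k = chainSum w 0 k := by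
    intro k
    induction k using Nat.strong_induction_on with
    | _ k ih =>
      intro h1 hk
      rw [ha k h1 hk, chainSum_eq_add_sum]
      congr 1
      refine Finset.sum_congr (by ext x; simp [Nat.one_le_iff_ne_zero, Nat.pos_iff_ne_zero])
        fun j hj => ?_
      obtain ⟨h0, hjk⟩ := Finset.mem_Ioo.mp hj
      rw [ih j hjk h0 (by omega)]
  have hmain : A = chainSum w 0 (N + 1) := by
    rw [hA, chainSum_eq_add_sum]
    congr 1
    refine Finset.sum_congr ?_ fun j hj => ?_
    · ext x
      simp only [Finset.mem_Ioo, Finset.mem_Icc]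
      omega
    · obtain ⟨h0, hjN⟩ := Finset.mem_Ioo.mp hj
      rw [hsum j h0 (by omega)]
  exact ⟨hmain.trans (sum_PiW_eq_chainSum w N).symm, hmain⟩
end

section
/- Let N ≥ 1, let w(i,j) be real numbers defined for all 0 ≤ i < j ≤ N+1, and let k ∈ {1,...,N}. Define a_1, ..., a_N by the forward recurrence a_m = w(0,m) + Σ_{j=1}^{m-1} a_j · w(j,m), and b_N, ..., b_1 by the backward recurrence b_m = w(m,N+1) + Σ_{j=m+1}^{N} w(m,j) · b_j. Then the sum, over all subsets I ⊆ {1,...,N} with k ∉ I, of Π(I) (the weight of the chain through {0} ∪ ({1,...,N} \ I) ∪ {N+1} in increasing order) equals a_k · b_k. -/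
theorem sort_union_insert {S T : Finset ℕ} {k : ℕ} (hS : ∀ x ∈ S, x < k) (hT : ∀ x ∈ T, k < x) :
    (S ∪ insert k T).sort (· ≤ ·) = S.sort (· ≤ ·) ++ k :: T.sort (· ≤ ·) := by
  have hsorted : (S.sort (· ≤ ·) ++ k :: T.sort (· ≤ ·)).Pairwise (· < ·) := by
    rw [List.pairwise_append, List.pairwise_cons]
    refine ⟨Finset.sortedLT_sort S |>.pairwise, ⟨fun x hx => hT x (by simpa using hx),
      Finset.sortedLT_sort T |>.pairwise⟩, fun x hx y hy => ?_⟩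
    have hx' := hS x (by simpa using hx)
    rcases List.mem_cons.1 hy with rfl | hy
    · exact hx'
    · exact hx'.trans (hT y (by simpa using hy))
  refine List.Perm.eq_of_pairwise' (Finset.pairwise_sort _ _) (hsorted.imp le_of_lt) ?_
  refine (List.perm_ext_iff_of_nodup (Finset.sort_nodup _ _) (hsorted.imp ne_of_lt)).2 fun x => ?_
  simp [or_left_comm]

theorem chainWeight_append_cons (w : ℕ → ℕ → ℝ) (l r : List ℕ) (k : ℕ) :
    chainWeight w (l ++ k :: r) = chainWeight w (l ++ [k]) * chainWeight w (k :: r) := by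
  induction l with
  | nil => simp [chainWeight]
  | cons x l ih =>
    cases l with
    | nil => simp [chainWeight]
    | cons y l =>
      simp only [List.cons_append, chainWeight] at ih ⊢
      rw [ih, mul_assoc]

theorem chainWeight_chainList_empty (w : ℕ → ℕ → ℝ) (i j : ℕ) :
    chainWeight w (chainList i j ∅) = w i j := by
  simp [chainList, chainWeight]

theorem chainWeight_chainList_union_insert (w : ℕ → ℕ → ℝ) (i j : ℕ) {S T : Finset ℕ} {k : ℕ}
    (hS : ∀ x ∈ S, x < k) (hT : ∀ x ∈ T, k < x) :
    chainWeight w (chainList i j (S ∪ insert k T)) =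
      chainWeight w (chainList i k S) * chainWeight w (chainList k j T) := by
  have h := chainWeight_append_cons w (i :: S.sort (· ≤ ·)) (T.sort (· ≤ ·) ++ [j]) k
  rw [chainList, sort_union_insert hS hT]
  simpa [chainList] using h

theorem sum_powerset_Ioo_chainWeight_left (w : ℕ → ℕ → ℝ) (i j n : ℕ) :
    ∑ S ∈ (Finset.Ioo i n).powerset, chainWeight w (chainList i j S) =
      w i j + ∑ m ∈ Finset.Ioo i n, chainSum w i m * w m j := by
  induction n with
  | zero => simp [chainWeight_chainList_empty]
  | succ n ih =>
    by_cases hin : i < n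
    · have hI : Finset.Ioo i (n + 1) = insert n (Finset.Ioo i n) := by
        ext x; simp only [Finset.mem_Ioo, Finset.mem_insert]; omega
      rw [hI, Finset.sum_powerset_insert (by simp), ih, Finset.sum_insert (by simp), chainSum,
        Finset.sum_mul, add_assoc, add_comm (Finset.sum _ _)]
      congr 2
      refine Finset.sum_congr rfl fun S hS => ?_
      have h := chainWeight_chainList_union_insert w i j (S := S) (T := ∅) (k := n)
        (fun x hx => (Finset.mem_Ioo.1 (Finset.mem_powerset.1 hS hx)).2) (by simp)
      rwa [chainWeight_chainList_empty, insert_empty_eq, Finset.union_singleton] at h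
    · have hI : Finset.Ioo i (n + 1) = ∅ := by
        ext x; simp only [Finset.mem_Ioo, Finset.notMem_empty, iff_false]; omega
      simp [hI, chainWeight_chainList_empty]

theorem sum_powerset_Ico_chainWeight_right (w : ℕ → ℕ → ℝ) (i j d : ℕ) :
    ∑ S ∈ (Finset.Ico (j - d) j).powerset, chainWeight w (chainList i j S) =
      w i j + ∑ m ∈ Finset.Ico (j - d) j, w i m * chainSum w m j := by
  induction d with
  | zero => simp [chainWeight_chainList_empty]
  | succ d ih =>
    by_cases hd : d < j
    · have hI : Finset.Ico (j - (d + 1)) j = insert (j - (d + 1)) (Finset.Ico (j - d) j) := by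
        ext x; simp only [Finset.mem_Ico, Finset.mem_insert]; omega
      have hIoo : Finset.Ico (j - d) j = Finset.Ioo (j - (d + 1)) j := by
        ext x; simp only [Finset.mem_Ico, Finset.mem_Ioo]; omega
      have hnot : j - (d + 1) ∉ Finset.Ico (j - d) j := by simp [hIoo]
      rw [hI, Finset.sum_powerset_insert hnot, ih, Finset.sum_insert hnot, chainSum,
        Finset.mul_sum, add_assoc, add_comm (Finset.sum _ _), ← hIoo]
      congr 2
      refine Finset.sum_congr rfl fun T hT => ?_
      rw [hIoo] at hT
      have h := chainWeight_chainList_union_insert w i j (S := ∅) (T := T) (k := j - (d + 1))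
        (by simp) (fun x hx => (Finset.mem_Ioo.1 (Finset.mem_powerset.1 hT hx)).1)
      rwa [chainWeight_chainList_empty, Finset.empty_union] at h
    · have hI : j - (d + 1) = j - d := by omega
      rw [hI, ih]

/-- Decomposition of a chain sum according to the last intermediate vertex. -/
theorem chainSum_eq_add_sum_mul_weight (w : ℕ → ℕ → ℝ) (i j : ℕ) :
    chainSum w i j = w i j + ∑ m ∈ Finset.Ioo i j, chainSum w i m * w m j :=
  sum_powerset_Ioo_chainWeight_left w i j j

/-- Decomposition of a chain sum according to the first intermediate vertex. -/
theorem chainSum_eq_add_sum_weight_mul (w : ℕ → ℕ → ℝ) (i j : ℕ) :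
    chainSum w i j = w i j + ∑ m ∈ Finset.Ioo i j, w i m * chainSum w m j := by
  have hI : Finset.Ioo i j = Finset.Ico (j - (j - (i + 1))) j := by
    ext x; simp only [Finset.mem_Ico, Finset.mem_Ioo]; omega
  rw [chainSum, hI]
  exact sum_powerset_Ico_chainWeight_right w i j (j - (i + 1))

/-- The chains from `i` to `j` through `k` contribute the product of the two chain sums. -/
theorem chainSum_mul_chainSum (w : ℕ → ℕ → ℝ) {i j k : ℕ} (hik : i < k) (hkj : k < j) :
    ∑ U ∈ (Finset.Ioo i j).powerset.filter (k ∈ ·), chainWeight w (chainList i j U) =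
      chainSum w i k * chainSum w k j := by
  rw [chainSum, chainSum, Finset.sum_mul_sum, ← Finset.sum_product']
  symm
  refine Finset.sum_nbij' (fun p => p.1 ∪ insert k p.2)
    (fun U => (U.filter (· < k), U.filter (k < ·))) ?_ ?_ ?_ ?_ ?_
  · rintro ⟨S, T⟩ h
    simp only [Finset.mem_product, Finset.mem_powerset, Finset.subset_iff, Finset.mem_Ioo,
      Finset.mem_filter, Finset.mem_union, Finset.mem_insert] at h ⊢
    grind
  · intro U h
    simp only [Finset.mem_product, Finset.mem_powerset, Finset.subset_iff, Finset.mem_Ioo,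
      Finset.mem_filter] at h ⊢
    grind
  · rintro ⟨S, T⟩ h
    simp only [Finset.mem_product, Finset.mem_powerset, Finset.subset_iff, Finset.mem_Ioo] at h
    ext x <;> simp only [Finset.mem_filter, Finset.mem_union, Finset.mem_insert] <;> grind
  · intro U h
    simp only [Finset.mem_filter] at h
    ext x
    simp only [Finset.mem_filter, Finset.mem_union, Finset.mem_insert]
    grind
  · rintro ⟨S, T⟩ h
    simp only [Finset.mem_product, Finset.mem_powerset] at h
    exact (chainWeight_chainList_union_insert w i j
      (fun x hx => (Finset.mem_Ioo.1 (h.1 hx)).2) (fun x hx => (Finset.mem_Ioo.1 (h.2 hx)).1)).symm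

theorem forward_eq_chainSum {w : ℕ → ℕ → ℝ} {N : ℕ} {a : ℕ → ℝ}
    (ha : ∀ m, 1 ≤ m → m ≤ N → a m = w 0 m + ∑ j ∈ Finset.Ico 1 m, a j * w j m)
    (m : ℕ) (hm : 1 ≤ m) (hmN : m ≤ N) : a m = chainSum w 0 m := by
  induction m using Nat.strong_induction_on with
  | _ m ih =>
    rw [ha m hm hmN, chainSum_eq_add_sum_mul_weight]
    congr 1
    refine Finset.sum_congr rfl fun j hj => ?_
    obtain ⟨h1, h2⟩ := Finset.mem_Ico.1 hj
    rw [ih j h2 h1 (h2.le.trans hmN)]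

theorem backward_eq_chainSum {w : ℕ → ℕ → ℝ} {N : ℕ} {b : ℕ → ℝ}
    (hb : ∀ m, 1 ≤ m → m ≤ N → b m = w m (N + 1) + ∑ j ∈ Finset.Ioc m N, w m j * b j)
    (m : ℕ) (hm : 1 ≤ m) (hmN : m ≤ N) : b m = chainSum w m (N + 1) := by
  induction hd : N - m using Nat.strong_induction_on generalizing m with
  | _ d ih =>
    have hI : Finset.Ioo m (N + 1) = Finset.Ioc m N := by
      ext x; simp only [Finset.mem_Ioo, Finset.mem_Ioc]; omega
    rw [hb m hm hmN, chainSum_eq_add_sum_weight_mul, hI]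
    congr 1
    refine Finset.sum_congr rfl fun j hj => ?_
    obtain ⟨h1, h2⟩ := Finset.mem_Ioc.1 hj
    rw [ih (N - j) (by omega) j (by omega) h2 rfl]

/-- the sum of `Π(I)` over subsets `I ⊆ {1,...,N}` not containing
`k` equals the product `a_k · b_k` of the forward and backward recurrences. -/
theorem sum_not_in_intrusion_eq_forward_mul_backward (N : ℕ) (hN : 1 ≤ N)
    (w : ℕ → ℕ → ℝ) (k : ℕ) (hk1 : 1 ≤ k) (hkN : k ≤ N)
    (a b : ℕ → ℝ)
    (ha : ∀ m, 1 ≤ m → m ≤ N →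
      a m = w 0 m + ∑ j ∈ Finset.Ico 1 m, a j * w j m)
    (hb : ∀ m, 1 ≤ m → m ≤ N →
      b m = w m (N + 1) + ∑ j ∈ Finset.Ioc m N, w m j * b j) :
    ∑ I ∈ (Finset.Icc 1 N).powerset.filter (fun I => k ∉ I), PiW w N I
      = a k * b k := by
  rw [forward_eq_chainSum ha k hk1 hkN, backward_eq_chainSum hb k hk1 hkN,
    ← chainSum_mul_chainSum w hk1 (Nat.lt_succ_of_le hkN)]
  have hI : Finset.Ioo 0 (N + 1) = Finset.Icc 1 N := by
    ext x; simp only [Finset.mem_Ioo, Finset.mem_Icc]; omega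
  rw [hI]
  refine Finset.sum_nbij' (Finset.Icc 1 N \ ·) (Finset.Icc 1 N \ ·) ?_ ?_ ?_ ?_ ?_
  · intro I h
    simp only [Finset.mem_filter, Finset.mem_powerset] at h ⊢
    exact ⟨Finset.sdiff_subset, Finset.mem_sdiff.2 ⟨Finset.mem_Icc.2 ⟨hk1, hkN⟩, h.2⟩⟩
  · intro U h
    simp only [Finset.mem_filter, Finset.mem_powerset] at h ⊢
    exact ⟨Finset.sdiff_subset, fun hk => (Finset.mem_sdiff.1 hk).2 h.2⟩
  · intro I h
    exact Finset.sdiff_sdiff_eq_self (Finset.mem_powerset.1 (Finset.mem_filter.1 h).1)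
  · intro U h
    exact Finset.sdiff_sdiff_eq_self (Finset.mem_powerset.1 (Finset.mem_filter.1 h).1)
  · intro I _
    rfl
end

section
/- Let λ > 0, let p ∈ ℝ, let t_1 ≤ t_2 ≤ ... ≤ t_N be real numbers, and define Q(j,k) = (1−p) · p^{k−j−1} · λ · exp(−λ·(t_k − t_j)) for 1 ≤ j < k ≤ N. Then for every strictly increasing sequence 1 ≤ k_1 < k_2 < ... < k_M ≤ N with M ≥ 2, Π_{j=1}^{M−1} Q(k_j, k_{j+1}) = (1−p)^{M−1} · p^{k_M − k_1 − (M−1)} · λ^{M−1} · exp(−λ·(t_{k_M} − t_{k_1})). In particular, this product depends only on k_1, k_M, t_{k_1}, t_{k_M}, and M, and not on the intermediate indices k_2, ..., k_{M−1} or the intermediate times. -/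
theorem add_le_of_lt_succ_on_Icc {k : ℕ → ℕ} (n : ℕ)
    (hmono : ∀ j, 1 ≤ j → j < n + 1 → k j < k (j + 1)) : k 1 + n ≤ k (n + 1) := by
  induction n with
  | zero => simp
  | succ n ih =>
    have h := ih fun j hj hjn => hmono j hj (by omega)
    have h' := hmono (n + 1) (by omega) (by omega)
    omega

theorem prod_poisson_transition (lam p : ℝ) (N : ℕ) (t : ℕ → ℝ) (Q : ℕ → ℕ → ℝ)
    (hQ : ∀ j k, 1 ≤ j → j < k → k ≤ N →
      Q j k = (1 - p) * p ^ (k - j - 1) * lam * Real.exp (-lam * (t k - t j)))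
    (k : ℕ → ℕ) (hk1 : 1 ≤ k 1) (n : ℕ) (hkN : k (n + 1) ≤ N)
    (hmono : ∀ j, 1 ≤ j → j < n + 1 → k j < k (j + 1)) :
    ∏ j ∈ Finset.Ico 1 (n + 1), Q (k j) (k (j + 1))
      = (1 - p) ^ n * p ^ (k (n + 1) - k 1 - n) * lam ^ n
          * Real.exp (-lam * (t (k (n + 1)) - t (k 1))) := by
  induction n with
  | zero => simp
  | succ n ih =>
    have hlast := hmono (n + 1) (by omega) (by omega)
    have hmono' : ∀ j, 1 ≤ j → j < n + 1 → k j < k (j + 1) :=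
      fun j hj hjn => hmono j hj (by omega)
    have hle := add_le_of_lt_succ_on_Icc n hmono'
    rw [Finset.prod_Ico_succ_top (by omega), ih (by omega) hmono',
      hQ _ _ (by omega) hlast hkN]
    have hpow : k (n + 1 + 1) - k 1 - (n + 1)
        = (k (n + 1) - k 1 - n) + (k (n + 1 + 1) - k (n + 1) - 1) := by omega
    have hexp : -lam * (t (k (n + 1 + 1)) - t (k 1))
        = -lam * (t (k (n + 1)) - t (k 1))
          + -lam * (t (k (n + 1 + 1)) - t (k (n + 1))) := by ring
    rw [hpow, hexp, Real.exp_add, pow_add p, pow_succ, pow_succ]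
    ring

/-- for a Poisson process (exponential interarrival density
`f(t) = λ exp(-λ t)`), the product of the transition factors
`Q(j,k) = (1-p) p^(k-j-1) λ exp(-λ (t_k - t_j))` along any chain
`1 ≤ k_1 < ... < k_M ≤ N` equals
`(1-p)^(M-1) p^(k_M - k_1 - (M-1)) λ^(M-1) exp(-λ (t_{k_M} - t_{k_1}))`,
and hence depends only on `k_1`, `k_M`, `t_{k_1}`, `t_{k_M}`, and `M`. -/
theorem poisson_transition_product_depends_only_on_endpoints
    (lam p : ℝ) (hlam : 0 < lam) (N : ℕ) (t : ℕ → ℝ)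
    (ht : ∀ i, 1 ≤ i → i < N → t i ≤ t (i + 1))
    (Q : ℕ → ℕ → ℝ)
    (hQ : ∀ j k, 1 ≤ j → j < k → k ≤ N →
      Q j k = (1 - p) * p ^ (k - j - 1) * lam * Real.exp (-lam * (t k - t j)))
    (M : ℕ) (hM : 2 ≤ M) (k : ℕ → ℕ)
    (hk1 : 1 ≤ k 1) (hkN : k M ≤ N)
    (hmono : ∀ j, 1 ≤ j → j < M → k j < k (j + 1)) :
    ∏ j ∈ Finset.Ico 1 M, Q (k j) (k (j + 1))
      = (1 - p) ^ (M - 1) * p ^ (k M - k 1 - (M - 1)) * lam ^ (M - 1)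
          * Real.exp (-lam * (t (k M) - t (k 1))) := by
  obtain ⟨n, rfl⟩ : ∃ n, M = n + 1 := ⟨M - 1, by omega⟩
  exact prod_poisson_transition lam p N t Q hQ k hk1 n hkN hmono
end
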